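/- The first Stieltjes constant γ₁ admits the convergent series representation γ₁ = −(1/π) · Σ_{n=1}^{∞} (1/(n·n!)) · Σ_{k=0}^{⌊n/2⌋} (−1)^k · (2k+1)! · H_{2k+1} · |S₁(n, 2k+1)| / (2π)^{2k+1}. -/

import Mathlib

open Finset Filter Real

/-- Unsigned Stirling numbers of the first kind `|S₁(n,l)|`: the coefficients in the
expansion of the rising factorial `z(z+1)⋯(z+n−1) = Σ_l |S₁(n,l)| z^l`. -/
noncomputable def S1 (n l : ℕ) : ℕ := (ascPochhammer ℕ n).coeff l

/-- The `n`-th harmonic number `H_n = Σ_{k=1}^n 1/k`. -/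
noncomputable def H (n : ℕ) : ℝ := ∑ k ∈ Finset.range n, (1 : ℝ) / (k + 1)

section StieltjesSeries

open MeasureTheory Set

theorem integrableOn_and_integral_pow_mul_exp_neg_mul_log (l : ℕ) :
    IntegrableOn (fun u : ℝ => u ^ l * Real.exp (-u) * Real.log u) (Ioi 0) ∧
      ∫ u in Ioi (0 : ℝ), u ^ l * Real.exp (-u) * Real.log u =
        l.factorial * (H l - Real.eulerMascheroniConstant) := by
  have hcong : ∀ u ∈ Ioi (0 : ℝ), ((u ^ l * Real.exp (-u) * Real.log u : ℝ) : ℂ) =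
      (u : ℂ) ^ (((l : ℂ) + 1) - 1) • (Real.log u • ((Real.exp (-u) : ℝ) : ℂ)) := by
    intro u hu
    rw [add_sub_cancel_right, Complex.cpow_natCast]
    simp only [smul_eq_mul, Complex.real_smul]
    push_cast
    ring
  have hs : 0 < ((l : ℂ) + 1).re := by simp; positivity
  have key := mellin_hasDerivAt_of_isBigO_rpow (E := ℂ) (f := fun x : ℝ => ((Real.exp (-x) : ℝ) : ℂ))
    (s := (l : ℂ) + 1) (a := ((l : ℂ) + 1).re + 1) (b := 0) ?_ ?_ (lt_add_one _) ?_ hs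
  · have hconv := key.1
    have hint : IntegrableOn (fun u : ℝ => ((u ^ l * Real.exp (-u) * Real.log u : ℝ) : ℂ))
        (Ioi 0) := by
      refine IntegrableOn.congr_fun hconv (fun u hu => (hcong u hu).symm) measurableSet_Ioi
    refine ⟨by
      simpa only [IntegrableOn, RCLike.re_eq_complex_re, Complex.ofReal_re] using hint.re, ?_⟩
    have hd := key.2
    rw [← Complex.GammaIntegral_eq_mellin] at hd
    have hd2 : HasDerivAt Complex.Gamma (l.factorial * (-Real.eulerMascheroniConstant + harmonic l))
      ((l : ℂ) + 1) := Complex.hasDerivAt_Gamma_nat l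
    have hd3 : HasDerivAt Complex.GammaIntegral
        (l.factorial * (-Real.eulerMascheroniConstant + harmonic l)) ((l : ℂ) + 1) := by
      refine hd2.congr_of_eventuallyEq ?_
      filter_upwards [(isOpen_lt continuous_const Complex.continuous_re).mem_nhds hs] with a ha
      exact (Complex.Gamma_eq_integral ha).symm
    have e := hd.unique hd3
    rw [mellin, setIntegral_congr_fun measurableSet_Ioi (fun u hu => (hcong u hu).symm)] at e
    replace e := (integral_ofReal (𝕜 := ℂ)).symm.trans e
    have hH : ((harmonic l : ℚ) : ℝ) = H l := by
      simp [harmonic, H]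
    rw [← hH]
    rw [← Complex.ofReal_inj]
    refine e.trans ?_
    push_cast
    ring
  · exact (Continuous.continuousOn (by fun_prop)).locallyIntegrableOn measurableSet_Ioi
  · rw [← Asymptotics.isBigO_norm_left]
    simp_rw [Complex.norm_real, Asymptotics.isBigO_norm_left]
    simpa only [neg_one_mul] using (isLittleO_exp_neg_mul_rpow_atTop zero_lt_one _).isBigO
  · simp_rw [neg_zero, Real.rpow_zero]
    refine Asymptotics.isBigO_const_of_tendsto (?_ : Tendsto _ _ (nhds (1 : ℂ))) one_ne_zero
    rw [(by simp : (1 : ℂ) = Real.exp (-0))]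
    exact (Continuous.continuousWithinAt (by fun_prop))

theorem integrableOn_pow_mul_exp_neg_mul (l : ℕ) {a : ℝ} (ha : 0 < a) :
    IntegrableOn (fun u : ℝ => u ^ l * Real.exp (-(a * u))) (Ioi 0) := by
  have h := integrableOn_rpow_mul_exp_neg_mul_rpow (p := 1) (s := l) (b := a)
    (by have : (0 : ℝ) ≤ l := by positivity
        linarith) one_pos ha
  refine h.congr_fun (fun u _ => ?_) measurableSet_Ioi
  simp

theorem integral_pow_mul_exp_neg (l : ℕ) :
    ∫ u in Ioi (0 : ℝ), u ^ l * Real.exp (-u) = l.factorial := by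
  rw [← Real.Gamma_nat_eq_factorial, Real.Gamma_eq_integral (by positivity)]
  refine setIntegral_congr_fun measurableSet_Ioi fun u _ => ?_
  simp [mul_comm]

/-- The weight `log u + γ`, whose integral against `exp (-u)` vanishes. -/
noncomputable def logWeight (u : ℝ) : ℝ := Real.log u + Real.eulerMascheroniConstant

theorem integrableOn_pow_mul_exp_neg_mul_logWeight (l : ℕ) {a : ℝ} (ha : 0 < a) :
    IntegrableOn (fun u : ℝ => u ^ l * Real.exp (-(a * u)) * logWeight u) (Ioi 0) := by
  have h1 := (integrableOn_Ioi_comp_mul_left_iff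
    (fun u : ℝ => u ^ l * Real.exp (-u) * Real.log u) 0 ha).2
    (by simpa using (integrableOn_and_integral_pow_mul_exp_neg_mul_log l).1)
  have h2 := (integrableOn_pow_mul_exp_neg_mul l ha).mul_const
    (Real.eulerMascheroniConstant - Real.log a)
  refine IntegrableOn.congr_fun ((h1.const_mul (a ^ l)⁻¹).add h2) (fun u hu => ?_)
    measurableSet_Ioi
  have hu' : (0 : ℝ) < u := hu
  simp only [Pi.add_apply, logWeight, Real.log_mul ha.ne' hu'.ne', mul_pow]
  field_simp
  ring

theorem integral_pow_mul_exp_neg_mul_logWeight (l : ℕ) :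
    ∫ u in Ioi (0 : ℝ), u ^ l * Real.exp (-u) * logWeight u = l.factorial * H l := by
  obtain ⟨h1, h2⟩ := integrableOn_and_integral_pow_mul_exp_neg_mul_log l
  have h3 := integrableOn_pow_mul_exp_neg_mul l one_pos
  simp only [one_mul] at h3
  simp only [logWeight, mul_add]
  rw [integral_add h1 (h3.mul_const _), h2, integral_mul_const, integral_pow_mul_exp_neg]
  ring

theorem integral_exp_neg_mul_logWeight {a : ℝ} (ha : 0 < a) :
    ∫ u in Ioi (0 : ℝ), Real.exp (-(a * u)) * logWeight u = -(Real.log a / a) := by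
  have h := integral_comp_mul_left_Ioi (fun u : ℝ => Real.exp (-u) * logWeight u) 0 ha
  have h0 := integral_pow_mul_exp_neg_mul_logWeight 0
  simp only [pow_zero, one_mul, H, Finset.range_zero, Finset.sum_empty, mul_zero] at h0
  rw [mul_zero, h0, smul_zero] at h
  have e : ∀ u ∈ Ioi (0 : ℝ), Real.exp (-(a * u)) * logWeight (a * u) =
      Real.exp (-(a * u)) * logWeight u + Real.log a * (u ^ 0 * Real.exp (-(a * u))) := by
    intro u hu
    have hu' : (0 : ℝ) < u := hu
    simp only [logWeight, Real.log_mul ha.ne' hu'.ne', pow_zero]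
    ring
  have hI := integrableOn_pow_mul_exp_neg_mul_logWeight 0 ha
  simp only [pow_zero, one_mul] at hI
  rw [setIntegral_congr_fun measurableSet_Ioi e, integral_add hI
    ((integrableOn_pow_mul_exp_neg_mul 0 ha).const_mul _), integral_const_mul] at h
  have h5 : ∫ u in Ioi (0 : ℝ), u ^ 0 * Real.exp (-(a * u)) = a⁻¹ := by
    have := integral_comp_mul_left_Ioi (fun u : ℝ => u ^ 0 * Real.exp (-u)) 0 ha
    rw [mul_zero, integral_pow_mul_exp_neg] at this
    simpa using this
  rw [h5] at h
  rw [div_eq_mul_inv]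
  linarith

theorem integrableOn_and_integral_integral_exp_mul_logWeight {N : ℝ} (hN : 1 ≤ N) :
    IntegrableOn (fun u : ℝ => (∫ t in (1 : ℝ)..N, Real.exp (-(t * u))) * logWeight u) (Ioi 0) ∧
    ∫ u in Ioi (0 : ℝ), (∫ t in (1 : ℝ)..N, Real.exp (-(t * u))) * logWeight u =
      -(Real.log N ^ 2 / 2) := by
  have hI := integrableOn_pow_mul_exp_neg_mul_logWeight 0 one_pos
  simp only [pow_zero, one_mul] at hI
  have hprod : Integrable (Function.uncurry fun u t : ℝ => Real.exp (-(t * u)) * logWeight u)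
      ((volume.restrict (Ioi 0)).prod (volume.restrict (Ioc 1 N))) := by
    have hb := hI.mul_prod (integrable_const (1 : ℝ) (μ := volume.restrict (Ioc 1 N)))
    refine hb.mono ?_ ?_
    · refine Measurable.aestronglyMeasurable ?_
      unfold logWeight Function.uncurry
      fun_prop
    · rw [Measure.prod_restrict]
      refine (ae_restrict_iff' (measurableSet_Ioi.prod measurableSet_Ioc)).2 (ae_of_all _ ?_)
      rintro ⟨u, t⟩ ⟨hu, ht⟩
      simp only [Function.uncurry, norm_mul, Real.norm_eq_abs, Real.abs_exp, mul_one]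
      gcongr
      have hu' : (0 : ℝ) < u := hu
      nlinarith [ht.1]
  have hs := integral_integral_swap hprod
  have hleft := hprod.integral_prod_left
  simp only [Function.uncurry, ← intervalIntegral.integral_of_le hN] at hs hleft
  simp only [intervalIntegral.integral_mul_const] at hs hleft
  refine ⟨hleft, ?_⟩
  rw [hs, intervalIntegral.integral_congr (g := fun t : ℝ => -(Real.log t / t))]
  · have hd : ∀ t ∈ uIcc 1 N, HasDerivAt (fun t : ℝ => -(Real.log t ^ 2 / 2))
        (-(Real.log t / t)) t := by
      intro t ht
      rw [uIcc_of_le hN] at ht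
      have h0 : t ≠ 0 := by linarith [ht.1]
      refine (((Real.hasDerivAt_log h0).pow 2).div_const 2).neg.congr_deriv ?_
      field_simp
      simp
    rw [intervalIntegral.integral_eq_sub_of_hasDerivAt hd]
    · simp
    · refine ContinuousOn.intervalIntegrable ?_
      rw [uIcc_of_le hN]
      refine ContinuousOn.neg (ContinuousOn.div (Real.continuousOn_log.mono ?_) continuousOn_id ?_)
      · intro t ht
        simp only [mem_compl_iff, mem_singleton_iff]
        linarith [ht.1]
      · intro t ht
        linarith [ht.1]
  · intro t ht
    rw [uIcc_of_le hN] at ht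
    exact integral_exp_neg_mul_logWeight (by linarith [ht.1])

theorem kernel_bounds {u : ℝ} (hu : 0 < u) :
    0 ≤ 1 / u - 1 / (Real.exp u - 1) ∧ 1 / u - 1 / (Real.exp u - 1) ≤ 1 := by
  have h1 := Real.add_one_le_exp u
  have h2 : 0 < Real.exp u - 1 := by linarith
  have h3 : (1 - u) * Real.exp u ≤ 1 := by
    have := Real.add_one_le_exp (-u)
    rw [Real.exp_neg] at this
    have h4 := Real.exp_pos u
    calc (1 - u) * Real.exp u ≤ (Real.exp u)⁻¹ * Real.exp u := by gcongr; linarith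
      _ = 1 := by field_simp
  refine ⟨sub_nonneg.2 (one_div_le_one_div_of_le hu (by linarith)), ?_⟩
  rw [div_sub_div _ _ hu.ne' h2.ne', div_le_one (by positivity)]
  nlinarith

theorem sum_exp_sub_integral_exp {u : ℝ} (hu : 0 < u) (n : ℕ) :
    ∑ k ∈ Finset.range n, Real.exp (-(((k : ℝ) + 1) * u)) -
        ∫ t in (1 : ℝ)..n, Real.exp (-(t * u)) =
      Real.exp (-u) * (1 - (1 / u - 1 / (Real.exp u - 1))) +
        Real.exp (-(n * u)) * (1 / u - 1 / (Real.exp u - 1)) := by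
  have h1 := Real.add_one_le_exp u
  have h2 : Real.exp u - 1 ≠ 0 := by linarith
  have hE : Real.exp (-u) = (Real.exp u)⁻¹ := Real.exp_neg u
  have hs : ∑ k ∈ Finset.range n, Real.exp (-(((k : ℝ) + 1) * u)) =
      (1 - Real.exp (-(n * u))) / (Real.exp u - 1) := by
    induction n with
    | zero => simp
    | succ n ih =>
      rw [Finset.sum_range_succ, ih]
      have : Real.exp (-(n * u)) = Real.exp u * Real.exp (-(((n : ℝ) + 1) * u)) := by
        rw [← Real.exp_add]
        ring_nf
      push_cast
      rw [this]
      field_simp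
      ring
  have hint : ∫ t in (1 : ℝ)..n, Real.exp (-(t * u)) =
      (Real.exp (-u) - Real.exp (-(n * u))) / u := by
    rw [intervalIntegral.integral_eq_sub_of_hasDerivAt
      (f := fun t : ℝ => -(Real.exp (-(t * u)) / u))]
    · simp only [one_mul]
      ring
    · intro t _
      have := ((((hasDerivAt_id t).mul_const u).neg.exp).div_const u).neg
      refine this.congr_deriv ?_
      simp
      field_simp
    · exact Continuous.intervalIntegrable (by fun_prop) _ _
  rw [hs, hint, hE]
  have := Real.exp_pos u
  field_simp
  ring

theorem sum_log_div_sub_eq_integral {n : ℕ} (hn : 1 ≤ n) :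
    (∑ k ∈ Finset.range n, Real.log (k + 1) / (k + 1)) - (Real.log n) ^ 2 / 2 =
      -∫ u in Ioi (0 : ℝ), (Real.exp (-u) * (1 - (1 / u - 1 / (Real.exp u - 1))) +
        Real.exp (-(n * u)) * (1 / u - 1 / (Real.exp u - 1))) * logWeight u := by
  have hI : ∀ a : ℝ, 0 < a →
      IntegrableOn (fun u : ℝ => Real.exp (-(a * u)) * logWeight u) (Ioi 0) := fun a ha => by
    simpa using integrableOn_pow_mul_exp_neg_mul_logWeight 0 ha
  have hn' : (1 : ℝ) ≤ n := by exact_mod_cast hn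
  have hk : ∀ k : ℕ, (0 : ℝ) < k + 1 := fun k => by positivity
  obtain ⟨hJ, hJ'⟩ := integrableOn_and_integral_integral_exp_mul_logWeight hn'
  have hsum : ∫ u in Ioi (0 : ℝ),
      ∑ k ∈ Finset.range n, Real.exp (-(((k : ℝ) + 1) * u)) * logWeight u =
      -∑ k ∈ Finset.range n, Real.log (k + 1) / (k + 1) := by
    rw [integral_finsetSum _ fun k _ => hI _ (hk k), ← Finset.sum_neg_distrib]
    exact Finset.sum_congr rfl fun k _ => integral_exp_neg_mul_logWeight (hk k)
  have hdiff := integral_sub (integrable_finsetSum (Finset.range n) fun k _ => hI _ (hk k)) hJ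
  rw [hsum, hJ'] at hdiff
  rw [setIntegral_congr_fun measurableSet_Ioi
    (g := fun u : ℝ => ∑ k ∈ Finset.range n, Real.exp (-(((k : ℝ) + 1) * u)) * logWeight u -
      (∫ t in (1 : ℝ)..n, Real.exp (-(t * u))) * logWeight u), hdiff]
  · ring
  · intro u hu
    simp only
    rw [← sum_exp_sub_integral_exp hu n, sub_mul, Finset.sum_mul]

theorem tendsto_sum_log_div_sub :
    Tendsto (fun n : ℕ =>
        (∑ k ∈ Finset.range n, Real.log (k + 1) / (k + 1)) - (Real.log n) ^ 2 / 2)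
      atTop (nhds (-∫ u in Ioi (0 : ℝ),
        Real.exp (-u) * (1 - (1 / u - 1 / (Real.exp u - 1))) * logWeight u)) := by
  have hI : IntegrableOn (fun u : ℝ => Real.exp (-u) * logWeight u) (Ioi 0) := by
    simpa using integrableOn_pow_mul_exp_neg_mul_logWeight 0 one_pos
  have hlim : Tendsto (fun n : ℕ => -∫ u in Ioi (0 : ℝ),
      (Real.exp (-u) * (1 - (1 / u - 1 / (Real.exp u - 1))) +
        Real.exp (-(n * u)) * (1 / u - 1 / (Real.exp u - 1))) * logWeight u) atTop
      (nhds (-∫ u in Ioi (0 : ℝ),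
        Real.exp (-u) * (1 - (1 / u - 1 / (Real.exp u - 1))) * logWeight u)) := by
    refine Tendsto.neg ?_
    refine tendsto_integral_filter_of_dominated_convergence
      (fun u => 2 * ‖Real.exp (-u) * logWeight u‖) ?_ ?_ (hI.norm.const_mul 2) ?_
    · refine Eventually.of_forall fun n => Measurable.aestronglyMeasurable ?_
      unfold logWeight
      fun_prop
    · filter_upwards [eventually_ge_atTop 1] with n hn
      refine (ae_restrict_iff' measurableSet_Ioi).2 (ae_of_all _ fun u hu => ?_)
      have hu' : (0 : ℝ) < u := hu
      obtain ⟨h1, h2⟩ := kernel_bounds hu'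
      have hn' : (1 : ℝ) ≤ n := by exact_mod_cast hn
      have h3 : Real.exp (-(n * u)) ≤ Real.exp (-u) := by
        gcongr
        nlinarith
      rw [norm_mul, norm_mul, ← mul_assoc]
      gcongr
      rw [Real.norm_eq_abs, Real.norm_eq_abs, Real.abs_exp, abs_of_nonneg]
      · nlinarith [Real.exp_pos (-u), Real.exp_pos (-(n * u))]
      · have := sub_nonneg.2 h2
        positivity
    · refine (ae_restrict_iff' measurableSet_Ioi).2 (ae_of_all _ fun u hu => ?_)
      have hu' : (0 : ℝ) < u := hu
      refine Tendsto.mul_const _ ?_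
      have h : Tendsto (fun n : ℕ => Real.exp (-(n * u))) atTop (nhds 0) :=
        Real.tendsto_exp_neg_atTop_nhds_zero.comp
          (tendsto_natCast_atTop_atTop.atTop_mul_const hu')
      simpa using (h.mul_const (1 / u - 1 / (Real.exp u - 1))).const_add
        (Real.exp (-u) * (1 - (1 / u - 1 / (Real.exp u - 1))))
  refine hlim.congr' ?_
  filter_upwards [eventually_ge_atTop 1] with n hn
  exact (sum_log_div_sub_eq_integral hn).symm

theorem prod_one_add_sq_div_sq_le {x : ℝ} (hx : 0 < x) (n : ℕ) :
    ∏ j ∈ Finset.range n, (1 + x ^ 2 / ((j : ℝ) + 1) ^ 2) ≤ Real.exp (π * x) := by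
  have h := (Complex.continuous_im.tendsto _).comp
    (Complex.tendsto_euler_sin_prod ((x : ℂ) * Complex.I))
  have e : ∀ n : ℕ, (Complex.im ∘ fun n : ℕ => (π : ℂ) * (x * Complex.I) *
      ∏ j ∈ Finset.range n, ((1 : ℂ) - (x * Complex.I) ^ 2 / ((j : ℂ) + 1) ^ 2)) n =
      π * x * ∏ j ∈ Finset.range n, (1 + x ^ 2 / ((j : ℝ) + 1) ^ 2) := by
    intro n
    have : (π : ℂ) * (x * Complex.I) *
        ∏ j ∈ Finset.range n, ((1 : ℂ) - (x * Complex.I) ^ 2 / ((j : ℂ) + 1) ^ 2) =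
        ((π * x * ∏ j ∈ Finset.range n, (1 + x ^ 2 / ((j : ℝ) + 1) ^ 2) : ℝ) : ℂ) *
          Complex.I := by
      push_cast
      simp only [mul_pow, Complex.I_sq, mul_neg, mul_one, neg_div, sub_neg_eq_add]
      ring
    simp only [Function.comp, this, Complex.im_ofReal_mul, Complex.I_im, mul_one]
  have e2 : (Complex.sin (π * ((x : ℂ) * Complex.I))).im = Real.sinh (π * x) := by
    rw [← mul_assoc, Complex.sin_mul_I, ← Complex.ofReal_mul, ← Complex.ofReal_sinh,
      Complex.im_ofReal_mul,
      Complex.I_im, mul_one]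
  rw [e2] at h
  have hmono : Monotone fun n : ℕ =>
      π * x * ∏ j ∈ Finset.range n, (1 + x ^ 2 / ((j : ℝ) + 1) ^ 2) := by
    refine monotone_nat_of_le_succ fun n => ?_
    rw [Finset.prod_range_succ]
    have h1 : 0 ≤ ∏ j ∈ Finset.range n, (1 + x ^ 2 / ((j : ℝ) + 1) ^ 2) :=
      Finset.prod_nonneg fun _ _ => by positivity
    have h2 : (1 : ℝ) ≤ 1 + x ^ 2 / ((n : ℝ) + 1) ^ 2 := le_add_of_nonneg_right (by positivity)
    have := Real.pi_pos
    gcongr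
    exact le_mul_of_one_le_right h1 h2
  have h3 := hmono.ge_of_tendsto (h.congr e) n
  have hy : 0 < π * x := mul_pos Real.pi_pos hx
  have h4 : Real.sinh (π * x) ≤ π * x * Real.exp (π * x) := by
    have h5 := Real.add_one_le_exp (-(2 * (π * x)))
    have h6 : Real.exp (-(π * x)) = Real.exp (π * x) * Real.exp (-(2 * (π * x))) := by
      rw [← Real.exp_add]
      ring_nf
    rw [Real.sinh_eq, h6]
    nlinarith [Real.exp_pos (π * x)]
  exact le_of_mul_le_mul_left (h3.trans h4) hy

theorem norm_ascPochhammer_mul_I_sq (x : ℝ) (n : ℕ) :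
    ‖(ascPochhammer ℂ (n + 1)).eval ((x : ℂ) * Complex.I)‖ ^ 2 =
      (x * n.factorial) ^ 2 * ∏ j ∈ Finset.range n, (1 + x ^ 2 / ((j : ℝ) + 1) ^ 2) := by
  induction n with
  | zero => simp
  | succ n ih =>
    have h : ‖(x : ℂ) * Complex.I + ((n + 1 : ℕ) : ℂ)‖ ^ 2 = x ^ 2 + ((n : ℝ) + 1) ^ 2 := by
      rw [← Complex.normSq_eq_norm_sq, Complex.normSq_apply]
      simp
      ring
    rw [ascPochhammer_succ_eval, norm_mul, mul_pow, ih, h, Finset.prod_range_succ,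
      Nat.factorial_succ]
    push_cast
    field_simp
    ring

theorem norm_ascPochhammer_mul_I_le {x : ℝ} (hx : 0 < x) (n : ℕ) :
    ‖(ascPochhammer ℂ (n + 1)).eval ((x : ℂ) * Complex.I)‖ ≤
      x * Real.exp (π * x / 2) * n.factorial := by
  refine le_of_sq_le_sq ?_ (by positivity)
  rw [norm_ascPochhammer_mul_I_sq]
  have h : Real.exp (π * x / 2) ^ 2 = Real.exp (π * x) := by
    rw [← Real.exp_nat_mul]
    congr 1
    push_cast
    ring
  calc _ ≤ (x * n.factorial) ^ 2 * Real.exp (π * x) := by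
        gcongr
        exact prod_one_add_sq_div_sq_le hx n
    _ = _ := by
        rw [← h]
        ring

theorem hasSum_one_div_ascFactorial (n : ℕ) :
    HasSum (fun k : ℕ => (1 : ℝ) / (k + 1).ascFactorial (n + 2))
      (1 / ((n + 1) * (n + 1).factorial)) := by
  have hpos : ∀ k m : ℕ, (0 : ℝ) < (k + 1).ascFactorial m := fun k m => by
    exact_mod_cast Nat.ascFactorial_pos k m
  rw [hasSum_iff_tendsto_nat_of_nonneg fun k => by positivity]
  have hpart : ∀ K : ℕ, ∑ k ∈ Finset.range K, (1 : ℝ) / (k + 1).ascFactorial (n + 2) =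
      (1 / ((n + 1) * (n + 1).factorial)) -
        1 / ((n + 1) * (K + 1).ascFactorial (n + 1)) := by
    intro K
    induction K with
    | zero => simp [Nat.one_ascFactorial]
    | succ K ih =>
      have h1 : ((K + 1).ascFactorial (n + 2) : ℝ) =
          (K + 1 + (n + 1)) * (K + 1).ascFactorial (n + 1) := by
        rw [Nat.ascFactorial_succ]
        push_cast
        ring
      have h2 : ((K : ℝ) + 1) * (K + 1 + 1).ascFactorial (n + 1) =
          (K + 1 + (n + 1)) * (K + 1).ascFactorial (n + 1) := by
        exact_mod_cast Nat.succ_ascFactorial (K + 1) (n + 1)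
      have h3 := hpos K (n + 1)
      have h4 : ((K + 1 + 1).ascFactorial (n + 1) : ℝ) =
          (K + 1 + (n + 1)) * (K + 1).ascFactorial (n + 1) / (K + 1) := by
        rw [← h2]
        field_simp
      rw [Finset.sum_range_succ, ih, h1, h4]
      field_simp
      ring
  simp only [hpart]
  have hlim : Tendsto (fun K : ℕ => (1 : ℝ) / ((n + 1) * (K + 1).ascFactorial (n + 1))) atTop
      (nhds 0) := by
    refine squeeze_zero (fun K => by positivity) (fun K => ?_)
      tendsto_one_div_add_atTop_nhds_zero_nat
    have h1 : ((K : ℝ) + 1) ≤ (K + 1).ascFactorial (n + 1) := by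
      exact_mod_cast (Nat.le_self_pow (Nat.succ_ne_zero n) (K + 1)).trans
        (Nat.pow_succ_le_ascFactorial (K + 1) (n + 1))
    gcongr
    nlinarith [(n.cast_nonneg : (0 : ℝ) ≤ n)]
  simpa using hlim.const_sub ((1 : ℝ) / ((n + 1) * (n + 1).factorial))

theorem sum_ascPochhammer_div_ascFactorial {z : ℂ} (k : ℕ) (hz : (k : ℂ) + 1 - z ≠ 0) (N : ℕ) :
    ∑ n ∈ Finset.range N,
        (ascPochhammer ℂ n).eval z / ((k + 1).ascFactorial (n + 1) : ℂ) =
      1 / ((k : ℂ) + 1 - z) -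
        (ascPochhammer ℂ N).eval z / ((k + 1).ascFactorial N * ((k : ℂ) + 1 - z)) := by
  have hne : ∀ m : ℕ, ((k + 1).ascFactorial m : ℂ) ≠ 0 := fun m => by
    exact_mod_cast (Nat.ascFactorial_pos k m).ne'
  induction N with
  | zero => simp
  | succ N ih =>
    have h1 : ((k + 1).ascFactorial (N + 1) : ℂ) =
        ((k : ℂ) + 1 + N) * (k + 1).ascFactorial N := by
      rw [Nat.ascFactorial_succ]
      push_cast
      ring
    have h2 : (k : ℂ) + 1 + N ≠ 0 := by exact_mod_cast (by omega : k + 1 + N ≠ 0)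
    have h3 := hne N
    rw [Finset.sum_range_succ, ih, h1, ascPochhammer_succ_eval]
    field_simp
    ring

theorem factorial_le_succ_ascFactorial (k n : ℕ) : n.factorial ≤ (k + 1).ascFactorial n := by
  rw [← Nat.one_ascFactorial, Nat.ascFactorial_eq_prod_range, Nat.ascFactorial_eq_prod_range]
  exact Finset.prod_le_prod' fun i _ => by omega

theorem hasSum_ascPochhammer_div {z : ℂ} (hz : ∀ k : ℕ, (k : ℂ) + 1 - z ≠ 0) {C : ℝ}
    (hC : ∀ n : ℕ, ‖(ascPochhammer ℂ (n + 1)).eval z‖ ≤ C * n.factorial) {s : ℂ}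
    (hs : HasSum (fun k : ℕ => 1 / ((k : ℂ) + 1 - z) - 1 / ((k : ℂ) + 1)) s) :
    HasSum (fun n : ℕ => (ascPochhammer ℂ (n + 1)).eval z / ((n + 1) * (n + 1).factorial)) s := by
  have hC0 : 0 ≤ C := by simpa using (norm_nonneg _).trans (hC 0)
  have hsq : Summable fun n : ℕ => C / ((n : ℝ) + 1) ^ 2 := by
    have := (summable_nat_add_iff 1).2 (Real.summable_one_div_nat_pow.2 one_lt_two)
    simpa [div_eq_mul_inv] using this.mul_left C
  set f : ℕ × ℕ → ℂ := fun p =>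
    (ascPochhammer ℂ (p.1 + 1)).eval z / ((p.2 + 1).ascFactorial (p.1 + 2) : ℂ) with hf
  have hfib : ∀ n : ℕ, HasSum (fun k : ℕ => f (n, k))
      ((ascPochhammer ℂ (n + 1)).eval z / ((n + 1) * (n + 1).factorial)) := fun n => by
    have := (Complex.hasSum_ofReal.2 (hasSum_one_div_ascFactorial n)).mul_left
      ((ascPochhammer ℂ (n + 1)).eval z)
    push_cast at this
    simpa only [hf, mul_one_div] using this
  have hnorm : ∀ n : ℕ, HasSum (fun k : ℕ => ‖f (n, k)‖)
      (‖(ascPochhammer ℂ (n + 1)).eval z‖ * (1 / ((n + 1) * (n + 1).factorial))) := fun n => by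
    have := (hasSum_one_div_ascFactorial n).mul_left ‖(ascPochhammer ℂ (n + 1)).eval z‖
    simpa only [hf, norm_div, Complex.norm_natCast, mul_one_div] using this
  have hsummable : Summable f := by
    refine Summable.of_norm ((summable_prod_of_nonneg fun _ => norm_nonneg _).2
      ⟨fun n => (hnorm n).summable, ?_⟩)
    simp only [(hnorm _).tsum_eq]
    refine hsq.of_nonneg_of_le (fun n => by positivity) fun n => ?_
    calc _ ≤ C * n.factorial * (1 / ((n + 1) * (n + 1).factorial)) := by
          gcongr
          exact hC n
      _ = _ := by
          rw [Nat.factorial_succ]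
          push_cast
          field_simp
  have hcol : ∀ k : ℕ, HasSum (fun n : ℕ => f (n, k))
      (1 / ((k : ℂ) + 1 - z) - 1 / ((k : ℂ) + 1)) := fun k => by
    refine (Summable.hasSum_iff_tendsto_nat
      (hsummable.comp_injective (Prod.mk_left_injective k))).2 ?_
    have hrem : Tendsto (fun N : ℕ => (ascPochhammer ℂ (N + 1)).eval z /
        ((k + 1).ascFactorial (N + 1) * ((k : ℂ) + 1 - z))) atTop (nhds 0) := by
      have hb : Tendsto (fun N : ℕ => C / ‖(k : ℂ) + 1 - z‖ * (1 / ((N : ℝ) + 1))) atTop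
          (nhds 0) := by
        simpa using tendsto_one_div_add_atTop_nhds_zero_nat.const_mul (C / ‖(k : ℂ) + 1 - z‖)
      refine squeeze_zero_norm (fun N => ?_) hb
      have h1 : (((N + 1).factorial : ℕ) : ℝ) ≤ (k + 1).ascFactorial (N + 1) := by
        exact_mod_cast factorial_le_succ_ascFactorial k (N + 1)
      have h2 : 0 < ‖(k : ℂ) + 1 - z‖ := norm_pos_iff.2 (hz k)
      rw [norm_div, norm_mul, Complex.norm_natCast]
      calc _ ≤ C * N.factorial / ((N + 1).factorial * ‖(k : ℂ) + 1 - z‖) := by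
            gcongr
            exact hC N
        _ = _ := by
            rw [Nat.factorial_succ]
            push_cast
            field_simp
    have hpart : ∀ N : ℕ, ∑ n ∈ Finset.range N, f (n, k) =
        1 / ((k : ℂ) + 1 - z) - 1 / ((k : ℂ) + 1) - (ascPochhammer ℂ (N + 1)).eval z /
        ((k + 1).ascFactorial (N + 1) * ((k : ℂ) + 1 - z)) := fun N => by
      have := sum_ascPochhammer_div_ascFactorial k (hz k) (N + 1)
      rw [Finset.sum_range_succ'] at this
      simp only [ascPochhammer_zero, Polynomial.eval_one, zero_add, Nat.ascFactorial_succ,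
        Nat.ascFactorial_zero, add_zero, mul_one, Nat.cast_add, Nat.cast_one] at this
      simp only [hf, Nat.ascFactorial_succ, Nat.cast_mul, Nat.cast_add, Nat.cast_one]
        at this ⊢
      linear_combination this
    refine Tendsto.congr (fun N => (hpart N).symm) ?_
    simpa using hrem.const_sub (1 / ((k : ℂ) + 1 - z) - 1 / ((k : ℂ) + 1))
  have htot := hsummable.hasSum
  have h1 : HasSum (fun k : ℕ => 1 / ((k : ℂ) + 1 - z) - 1 / ((k : ℂ) + 1)) (∑' p, f p) :=
    ((Equiv.prodComm ℕ ℕ).hasSum_iff.2 htot).prod_fiberwise hcol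
  rw [hs.unique h1]
  exact htot.prod_fiberwise hfib

theorem hasSum_div_sq_add_sq {x : ℝ} (hx : 0 < x) :
    HasSum (fun k : ℕ => x / (((k : ℝ) + 1) ^ 2 + x ^ 2))
      (π * (1 / 2 + 1 / (Real.exp (2 * π * x) - 1) - 1 / (2 * π * x))) := by
  have hz : (x : ℂ) * Complex.I ∈ Complex.integerComplement :=
    UpperHalfPlane.coe_mem_integerComplement ⟨(x : ℂ) * Complex.I, by simpa using hx⟩
  have h := (summable_cotTerm hz).hasSum
  have hE : 1 < Real.exp (2 * π * x) := Real.one_lt_exp_iff.2 (by positivity)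
  have hval : ∑' n, cotTerm ((x : ℂ) * Complex.I) n =
      ((-2 * (π * (1 / 2 + 1 / (Real.exp (2 * π * x) - 1) - 1 / (2 * π * x))) : ℝ) : ℂ) *
        Complex.I := by
    have e1 : Complex.exp (2 * π * Complex.I * (x * Complex.I)) =
        ((Real.exp (2 * π * x) : ℝ) : ℂ)⁻¹ := by
      rw [Complex.ofReal_exp, ← Complex.exp_neg]
      congr 1
      push_cast
      linear_combination (2 * π * x : ℂ) * Complex.I_sq
    have h2 := cot_series_rep' hz
    rw [Complex.cot_pi_eq_exp_ratio, e1] at h2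
    simp only [cotTerm]
    rw [← h2]
    have hE1 : ((Real.exp (2 * π * x) : ℝ) : ℂ) - 1 ≠ 0 := by
      exact_mod_cast (sub_pos.2 hE).ne'
    have hE0 : ((Real.exp (2 * π * x) : ℝ) : ℂ) ≠ 0 := by
      exact_mod_cast (Real.exp_pos _).ne'
    have hE2 : 1 - ((Real.exp (2 * π * x) : ℝ) : ℂ)⁻¹ ≠ 0 := by
      field_simp
      exact div_ne_zero hE1 hE0
    have hx0 : (x : ℂ) ≠ 0 := by exact_mod_cast hx.ne'
    have hpi : (π : ℂ) ≠ 0 := by exact_mod_cast Real.pi_ne_zero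
    push_cast at *
    generalize Complex.exp (2 * π * x) = E at *
    have hEE : (E⁻¹ + 1) / (Complex.I * (1 - E⁻¹)) = -Complex.I * ((E + 1) / (E - 1)) := by
      have : 1 - E⁻¹ = (E - 1) / E := by field_simp
      rw [this]
      field_simp
      rw [Complex.I_sq]
      ring
    have hxi : 1 / ((x : ℂ) * Complex.I) = -Complex.I / x := by
      field_simp
      rw [Complex.I_sq, neg_neg]
    rw [hEE, hxi]
    field_simp
    ring
  rw [hval] at h
  have h3 := (Complex.hasSum_im h).mul_left (-(1 / 2))
  have hterm : ∀ k : ℕ, cotTerm ((x : ℂ) * Complex.I) k =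
      ((-2 * (x / (((k : ℝ) + 1) ^ 2 + x ^ 2)) : ℝ) : ℂ) * Complex.I := fun k => by
    have h1 : ((k : ℂ) + 1) ^ 2 + (x : ℂ) ^ 2 ≠ 0 := by
      have : (0 : ℝ) < ((k : ℝ) + 1) ^ 2 + x ^ 2 := by positivity
      exact_mod_cast this.ne'
    have h2 : ((x : ℂ) * Complex.I + (k + 1)) * ((x : ℂ) * Complex.I - (k + 1)) =
        -(((k : ℂ) + 1) ^ 2 + (x : ℂ) ^ 2) := by
      linear_combination (x : ℂ) ^ 2 * Complex.I_sq
    rw [cotTerm_identity hz, h2]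
    push_cast
    field_simp
  simp only [hterm, Complex.im_ofReal_mul, Complex.I_im, mul_one, ← mul_assoc] at h3
  norm_num at h3
  simpa using h3

theorem hasSum_im_ascPochhammer_div {x : ℝ} (hx : 0 < x) :
    HasSum (fun n : ℕ => ((ascPochhammer ℂ (n + 1)).eval ((x : ℂ) * Complex.I)).im /
        ((n + 1) * (n + 1).factorial))
      (π * (1 / 2 + 1 / (Real.exp (2 * π * x) - 1) - 1 / (2 * π * x))) := by
  have hz : ∀ k : ℕ, (k : ℂ) + 1 - (x : ℂ) * Complex.I ≠ 0 := fun k h => by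
    have := congrArg Complex.im h
    simp at this
    exact hx.ne' this
  have hterm : ∀ k : ℕ, 1 / ((k : ℂ) + 1 - (x : ℂ) * Complex.I) - 1 / ((k : ℂ) + 1) =
      ((-(x ^ 2 / (((k : ℝ) + 1) * (((k : ℝ) + 1) ^ 2 + x ^ 2))) : ℝ) : ℂ) +
        ((x / (((k : ℝ) + 1) ^ 2 + x ^ 2) : ℝ) : ℂ) * Complex.I := fun k => by
    have h0 : (k : ℂ) + 1 ≠ 0 := by exact_mod_cast k.succ_ne_zero
    have h1 : ((k : ℂ) + 1) ^ 2 + (x : ℂ) ^ 2 ≠ 0 := by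
      have : (0 : ℝ) < ((k : ℝ) + 1) ^ 2 + x ^ 2 := by positivity
      exact_mod_cast this.ne'
    have h2 := hz k
    push_cast
    field_simp
    linear_combination (x : ℂ) ^ 2 * ((k : ℂ) + 1) * Complex.I_sq
  have hsum := hasSum_div_sq_add_sq hx
  have hre : Summable fun k : ℕ => -(x ^ 2 / (((k : ℝ) + 1) * (((k : ℝ) + 1) ^ 2 + x ^ 2))) := by
    refine Summable.neg ((hsum.summable.mul_left x).of_nonneg_of_le
      (fun k => by positivity) fun k => ?_)
    rw [← mul_div_assoc, ← pow_two]
    gcongr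
    have : (0 : ℝ) ≤ k * (((k : ℝ) + 1) ^ 2 + x ^ 2) := by positivity
    linarith
  have hs := (Complex.hasSum_ofReal.2 hre.hasSum).add
    ((Complex.hasSum_ofReal.2 hsum).mul_right Complex.I)
  simp only [← hterm] at hs
  have h := Complex.hasSum_im (hasSum_ascPochhammer_div hz (norm_ascPochhammer_mul_I_le hx) hs)
  have e : ∀ n : ℕ, ((ascPochhammer ℂ (n + 1)).eval ((x : ℂ) * Complex.I) /
      ((n + 1) * (n + 1).factorial)).im = ((ascPochhammer ℂ (n + 1)).eval
        ((x : ℂ) * Complex.I)).im / ((n + 1) * (n + 1).factorial) := fun n => by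
    rw [← Complex.div_ofReal_im]
    push_cast
    rfl
  simp only [e] at h
  convert h using 1
  rw [Complex.add_im, Complex.ofReal_im, zero_add, Complex.im_ofReal_mul, Complex.I_im, mul_one]

theorem sum_range_two_mul (f : ℕ → ℂ) (m : ℕ) :
    ∑ l ∈ Finset.range (2 * m), f l =
      ∑ k ∈ Finset.range m, (f (2 * k) + f (2 * k + 1)) := by
  induction m with
  | zero => simp
  | succ m ih => rw [mul_add_one, Finset.sum_range_succ, Finset.sum_range_succ, ih,
      Finset.sum_range_succ, add_assoc]

theorem im_ascPochhammer_mul_I (x : ℝ) (n : ℕ) :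
    ((ascPochhammer ℂ n).eval ((x : ℂ) * Complex.I)).im =
      ∑ k ∈ Finset.range (n / 2 + 1), (-1 : ℝ) ^ k * S1 n (2 * k + 1) * x ^ (2 * k + 1) := by
  rw [Polynomial.eval_eq_sum_range' (n := 2 * (n / 2 + 1))
    (by rw [ascPochhammer_natDegree]; omega), sum_range_two_mul, Complex.im_sum]
  refine Finset.sum_congr rfl fun k _ => ?_
  have hc : ∀ l, (ascPochhammer ℂ n).coeff l = (S1 n l : ℂ) := fun l => by
    rw [← ascPochhammer_map (Nat.castRingHom ℂ), Polynomial.coeff_map, S1]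
    simp
  have h0 : ((x : ℂ) * Complex.I) ^ (2 * k) = (((-1) ^ k * x ^ (2 * k) : ℝ) : ℂ) := by
    rw [mul_pow, pow_mul Complex.I, Complex.I_sq]
    push_cast
    ring
  rw [hc, hc, pow_succ, h0]
  have h1 : (S1 n (2 * k) : ℂ) * (((-1) ^ k * x ^ (2 * k) : ℝ) : ℂ) +
      (S1 n (2 * k + 1) : ℂ) * ((((-1) ^ k * x ^ (2 * k) : ℝ) : ℂ) * (x * Complex.I)) =
      ((S1 n (2 * k) * ((-1) ^ k * x ^ (2 * k)) : ℝ) : ℂ) +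
      (((-1 : ℝ) ^ k * S1 n (2 * k + 1) * x ^ (2 * k + 1) : ℝ) : ℂ) * Complex.I := by
    push_cast
    ring
  rw [h1, Complex.add_im, Complex.ofReal_im, zero_add, Complex.im_ofReal_mul, Complex.I_im,
    mul_one]

theorem integral_exp_neg_mul_logWeight_mul_im_ascPochhammer (n : ℕ) :
    IntegrableOn (fun u : ℝ => Real.exp (-u) * logWeight u *
      ((ascPochhammer ℂ n).eval (((u / (2 * π) : ℝ) : ℂ) * Complex.I)).im) (Ioi 0) ∧
    ∫ u in Ioi (0 : ℝ), Real.exp (-u) * logWeight u *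
      ((ascPochhammer ℂ n).eval (((u / (2 * π) : ℝ) : ℂ) * Complex.I)).im =
      ∑ k ∈ Finset.range (n / 2 + 1), (-1 : ℝ) ^ k * (Nat.factorial (2 * k + 1)) *
        H (2 * k + 1) * (S1 n (2 * k + 1)) / (2 * π) ^ (2 * k + 1) := by
  have e : ∀ u : ℝ, Real.exp (-u) * logWeight u *
      ((ascPochhammer ℂ n).eval (((u / (2 * π) : ℝ) : ℂ) * Complex.I)).im =
      ∑ k ∈ Finset.range (n / 2 + 1), ((-1 : ℝ) ^ k * S1 n (2 * k + 1) / (2 * π) ^ (2 * k + 1)) *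
        (u ^ (2 * k + 1) * Real.exp (-u) * logWeight u) := fun u => by
    rw [im_ascPochhammer_mul_I, Finset.mul_sum]
    refine Finset.sum_congr rfl fun k _ => ?_
    rw [div_pow]
    ring
  have hI : ∀ l : ℕ, IntegrableOn (fun u : ℝ => u ^ l * Real.exp (-u) * logWeight u) (Ioi 0) :=
    fun l => by simpa using integrableOn_pow_mul_exp_neg_mul_logWeight l one_pos
  simp only [e]
  refine ⟨integrable_finsetSum _ fun k _ => (hI _).const_mul _, ?_⟩
  rw [integral_finsetSum _ fun k _ => (hI _).const_mul _]
  refine Finset.sum_congr rfl fun k _ => ?_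
  rw [integral_const_mul, integral_pow_mul_exp_neg_mul_logWeight]
  ring

theorem hasSum_integral_im_ascPochhammer :
    HasSum (fun n : ℕ => (1 : ℝ) / ((n + 1) * (n + 1).factorial) *
      ∫ u in Ioi (0 : ℝ), Real.exp (-u) * logWeight u *
        ((ascPochhammer ℂ (n + 1)).eval (((u / (2 * π) : ℝ) : ℂ) * Complex.I)).im)
      (∫ u in Ioi (0 : ℝ), Real.exp (-u) * logWeight u *
        (π * (1 / 2 + 1 / (Real.exp u - 1) - 1 / u))) := by
  have hpi := Real.pi_pos
  set F : ℕ → ℝ → ℝ := fun n u => (1 : ℝ) / ((n + 1) * (n + 1).factorial) *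
    (Real.exp (-u) * logWeight u *
      ((ascPochhammer ℂ (n + 1)).eval (((u / (2 * π) : ℝ) : ℂ) * Complex.I)).im) with hF
  have hFint : ∀ n, IntegrableOn (F n) (Ioi 0) := fun n =>
    (integral_exp_neg_mul_logWeight_mul_im_ascPochhammer (n + 1)).1.const_mul _
  have hb := (integrableOn_pow_mul_exp_neg_mul_logWeight 1
    (by norm_num : (0 : ℝ) < 3 / 4)).norm
  have hbound : ∀ (n : ℕ), ∀ u ∈ Ioi (0 : ℝ), ‖F n u‖ ≤ 1 / (2 * π) * (1 / ((n : ℝ) + 1) ^ 2) *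
      ‖u ^ 1 * Real.exp (-(3 / 4 * u)) * logWeight u‖ := fun n u hu => by
    have hu' : (0 : ℝ) < u := hu
    have h1 := (Complex.abs_im_le_norm _).trans
      (norm_ascPochhammer_mul_I_le (x := u / (2 * π)) (by positivity) n)
    have h2 : Real.exp (-u) * Real.exp (π * (u / (2 * π)) / 2) = Real.exp (-(3 / 4 * u)) := by
      rw [← Real.exp_add]
      congr 1
      field_simp
      ring
    simp only [hF, norm_mul, Real.norm_eq_abs, Real.abs_exp]
    rw [abs_of_pos (by positivity : (0 : ℝ) < 1 / ((n + 1) * (n + 1).factorial)),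
      abs_of_pos (by positivity : (0 : ℝ) < u ^ 1), ← h2]
    calc _ ≤ 1 / (((n : ℝ) + 1) * (n + 1).factorial) * (Real.exp (-u) * |logWeight u| *
          (u / (2 * π) * Real.exp (π * (u / (2 * π)) / 2) * n.factorial)) := by gcongr
      _ = _ := by
          rw [Nat.factorial_succ]
          push_cast
          field_simp
  have hsq : Summable fun n : ℕ => 1 / ((n : ℝ) + 1) ^ 2 := by
    have := (summable_nat_add_iff 1).2 (Real.summable_one_div_nat_pow.2 one_lt_two)
    simpa using this
  have hsummable : Summable fun n => ∫ u in Ioi (0 : ℝ), ‖F n u‖ := by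
    refine ((hsq.mul_left (1 / (2 * π))).mul_right
      (∫ u in Ioi (0 : ℝ), ‖u ^ 1 * Real.exp (-(3 / 4 * u)) * logWeight u‖)).of_nonneg_of_le
      (fun n => integral_nonneg fun u => norm_nonneg _) fun n => ?_
    rw [← integral_const_mul]
    exact setIntegral_mono_on (hFint n).norm (hb.const_mul _) measurableSet_Ioi (hbound n)
  have h := hasSum_integral_of_summable_integral_norm hFint hsummable
  have htsum : ∀ u ∈ Ioi (0 : ℝ), ∑' n, F n u =
      Real.exp (-u) * logWeight u * (π * (1 / 2 + 1 / (Real.exp u - 1) - 1 / u)) := fun u hu => by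
    have hu' : (0 : ℝ) < u := hu
    have h1 := (hasSum_im_ascPochhammer_div (x := u / (2 * π)) (by positivity)).mul_left
      (Real.exp (-u) * logWeight u)
    rw [mul_div_cancel₀ u (by positivity : 2 * π ≠ 0)] at h1
    rw [← h1.tsum_eq]
    refine tsum_congr fun n => ?_
    simp only [hF]
    ring
  rw [setIntegral_congr_fun measurableSet_Ioi htsum] at h
  simpa only [hF, integral_const_mul] using h

theorem integral_exp_neg_mul_logWeight_mul_half_add :
    -(1 / π) * ∫ u in Ioi (0 : ℝ), Real.exp (-u) * logWeight u *
        (π * (1 / 2 + 1 / (Real.exp u - 1) - 1 / u)) =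
      -∫ u in Ioi (0 : ℝ),
        Real.exp (-u) * (1 - (1 / u - 1 / (Real.exp u - 1))) * logWeight u := by
  have hI : IntegrableOn (fun u : ℝ => Real.exp (-u) * logWeight u) (Ioi 0) := by
    simpa using integrableOn_pow_mul_exp_neg_mul_logWeight 0 one_pos
  have h0 : ∫ u in Ioi (0 : ℝ), Real.exp (-u) * logWeight u = 0 := by
    simpa using integral_exp_neg_mul_logWeight one_pos
  have hJ : IntegrableOn (fun u : ℝ =>
      Real.exp (-u) * (1 - (1 / u - 1 / (Real.exp u - 1))) * logWeight u) (Ioi 0) := by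
    refine Integrable.mono hI (Measurable.aestronglyMeasurable ?_)
      ((ae_restrict_iff' measurableSet_Ioi).2 (ae_of_all _ fun u hu => ?_))
    · unfold logWeight
      fun_prop
    · obtain ⟨h1, h2⟩ := kernel_bounds hu
      rw [norm_mul, norm_mul, norm_mul]
      gcongr
      refine mul_le_of_le_one_right (norm_nonneg _) ?_
      rw [Real.norm_eq_abs, abs_le]
      constructor <;> linarith
  have e : ∀ u : ℝ, Real.exp (-u) * logWeight u *
      (π * (1 / 2 + 1 / (Real.exp u - 1) - 1 / u)) =
      π * (Real.exp (-u) * (1 - (1 / u - 1 / (Real.exp u - 1))) * logWeight u -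
        1 / 2 * (Real.exp (-u) * logWeight u)) := fun u => by ring
  simp only [e]
  rw [integral_const_mul, integral_sub hJ (hI.const_mul _), integral_const_mul, h0]
  have := Real.pi_pos.ne'
  field_simp
  ring

end StieltjesSeries

/-- The first Stieltjes constant `γ₁ = lim (Σ_{k=1}^n ln k / k − ln² n / 2)` equals
`−(1/π) Σ_{n≥1} (1/(n·n!)) Σ_{k=0}^{⌊n/2⌋} (−1)^k (2k+1)! H_{2k+1} |S₁(n,2k+1)| / (2π)^{2k+1}`,
the series being convergent. -/
theorem first_stieltjes_series_pi (γ₁ : ℝ)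
    (hγ : Tendsto (fun n : ℕ =>
        (∑ k ∈ Finset.range n, Real.log (k + 1) / (k + 1)) - (Real.log n) ^ 2 / 2)
      atTop (nhds γ₁)) :
    HasSum (fun n : ℕ =>
      (-(1 / Real.pi)) *
        ((1 : ℝ) / ((n + 1) * Nat.factorial (n + 1)) *
          ∑ k ∈ Finset.range ((n + 1) / 2 + 1),
            (-1 : ℝ) ^ k * (Nat.factorial (2 * k + 1)) * H (2 * k + 1) *
              (S1 (n + 1) (2 * k + 1)) / (2 * Real.pi) ^ (2 * k + 1)))
      γ₁ := by
  rw [tendsto_nhds_unique hγ tendsto_sum_log_div_sub,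
    ← integral_exp_neg_mul_logWeight_mul_half_add]
  have h := hasSum_integral_im_ascPochhammer.mul_left (-(1 / Real.pi))
  simpa only [(integral_exp_neg_mul_logWeight_mul_im_ascPochhammer _).2] using h
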